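/- Converse half of Theorem 1: for any pmf p = p(q)p(x1|q)p(x2|q), if the rate pair (R1, R2) is such that the probability of error of the maximum likelihood decoders, averaged over the (2^{nR1}, 2^{nR2}, n; p) random code ensemble, tends to 0 as n → ∞, then (R1, R2) lies in R1(p) ∩ R2(p) (i.e., in its closure). -/

import Mathlib

open scoped BigOperators
open Filter

set_option synthInstance.maxSize 4000
set_option synthInstance.maxHeartbeats 1000000
set_option maxHeartbeats 1000000

noncomputable section

/-- Shannon entropy (base 2) of a finitely supported distribution `p`. -/
def ent {α : Type*} [Fintype α] (p : α → ℝ) : ℝ := -∑ a, p a * Real.logb 2 (p a)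

/-- The distribution (pushforward) of a random variable `f` on the finite
probability space `(Ω, p)`. -/
def distOf {Ω β : Type*} [Fintype Ω] [DecidableEq β] (p : Ω → ℝ) (f : Ω → β) : β → ℝ :=
  fun b => ∑ ω, if f ω = b then p ω else 0

/-- The entropy `H(f)` of a random variable `f` on the finite probability space `(Ω, p)`. -/
def entOf {Ω β : Type*} [Fintype Ω] [Fintype β] [DecidableEq β] (p : Ω → ℝ) (f : Ω → β) : ℝ :=
  ent (distOf p f)

/-- The conditional entropy `H(f | g)`. -/
def condEnt {Ω β γ : Type*} [Fintype Ω] [Fintype β] [Fintype γ] [DecidableEq β] [DecidableEq γ]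
    (p : Ω → ℝ) (f : Ω → β) (g : Ω → γ) : ℝ :=
  entOf p (fun ω => (f ω, g ω)) - entOf p g

/-- The mutual information `I(f; g)`. -/
def mutInfo {Ω β γ : Type*} [Fintype Ω] [Fintype β] [Fintype γ] [DecidableEq β] [DecidableEq γ]
    (p : Ω → ℝ) (f : Ω → β) (g : Ω → γ) : ℝ :=
  entOf p f + entOf p g - entOf p (fun ω => (f ω, g ω))

/-- The conditional mutual information `I(f; g | h)`. -/
def condMutInfo {Ω β γ δ : Type*} [Fintype Ω] [Fintype β] [Fintype γ] [Fintype δ]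
    [DecidableEq β] [DecidableEq γ] [DecidableEq δ]
    (p : Ω → ℝ) (f : Ω → β) (g : Ω → γ) (h : Ω → δ) : ℝ :=
  entOf p (fun ω => (f ω, h ω)) + entOf p (fun ω => (g ω, h ω)) -
    entOf p (fun ω => (f ω, g ω, h ω)) - entOf p h

/-- `p` is a probability mass function on the finite alphabet `α`. -/
def IsPMF {α : Type*} [Fintype α] (p : α → ℝ) : Prop := (∀ a, 0 ≤ p a) ∧ ∑ a, p a = 1

/-- The number `2^{nR}` of messages at blocklength `n` and rate `R` (in bits). -/
def msgSize (n : ℕ) (R : ℝ) : ℕ := max 1 ⌊(2 : ℝ) ^ ((n : ℝ) * R)⌋₊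

instance (n : ℕ) (R : ℝ) : NeZero (msgSize n R) :=
  ⟨by have h : 1 ≤ msgSize n R := le_max_left _ _; omega⟩

/-- The `ε`-typical set: `xs` is `ε`-typical for the pmf `p` if the empirical frequency of
every symbol `a` is within `ε · p a` of `p a`. -/
def Typical {α : Type*} [Fintype α] [DecidableEq α] (p : α → ℝ) (ε : ℝ) {n : ℕ}
    (xs : Fin n → α) : Prop :=
  ∀ a, |((Finset.univ.filter fun i => xs i = a).card : ℝ) / (n : ℝ) - p a| ≤ ε * p a

section TwoUser

variable {Q X1 X2 Y1 Y2 : Type*} [Fintype Q] [DecidableEq Q] [Fintype X1] [DecidableEq X1]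
  [Fintype X2] [DecidableEq X2] [Fintype Y1] [DecidableEq Y1] [Fintype Y2] [DecidableEq Y2]

variable (pQ : Q → ℝ) (pX1 : Q → X1 → ℝ) (pX2 : Q → X2 → ℝ) (W : X1 → X2 → Y1 × Y2 → ℝ)

/-- The single-letter joint distribution of `(Q, X1, X2, Y1, Y2)` induced by the input pmf
`p(q) p(x1|q) p(x2|q)` and the channel `p(y1, y2 | x1, x2)`. -/
def jointP : Q × X1 × X2 × Y1 × Y2 → ℝ := fun z =>
  pQ z.1 * pX1 z.1 z.2.1 * pX2 z.1 z.2.2.1 * W z.2.1 z.2.2.1 (z.2.2.2.1, z.2.2.2.2)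

def vQ : Q × X1 × X2 × Y1 × Y2 → Q := fun z => z.1
def vX1 : Q × X1 × X2 × Y1 × Y2 → X1 := fun z => z.2.1
def vX2 : Q × X1 × X2 × Y1 × Y2 → X2 := fun z => z.2.2.1
def vY1 : Q × X1 × X2 × Y1 × Y2 → Y1 := fun z => z.2.2.2.1
def vY2 : Q × X1 × X2 × Y1 × Y2 → Y2 := fun z => z.2.2.2.2

/-- The rate region `𝓡₁(p)` for receiver 1: either `R1 ≤ I(X1; Y1 | Q)`, or both
`R2 ≤ I(X2; Y1 | X1, Q)` and `R1 + R2 ≤ I(X1, X2; Y1 | Q)`. -/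
def Region1 : Set (ℝ × ℝ) :=
  {r | 0 ≤ r.1 ∧ 0 ≤ r.2 ∧
    (r.1 ≤ condMutInfo (jointP pQ pX1 pX2 W) vX1 vY1 vQ ∨
      (r.2 ≤ condMutInfo (jointP pQ pX1 pX2 W) vX2 vY1 (fun z => (vX1 z, vQ z)) ∧
        r.1 + r.2 ≤ condMutInfo (jointP pQ pX1 pX2 W) (fun z => (vX1 z, vX2 z)) vY1 vQ))}

/-- The rate region `𝓡₂(p)` for receiver 2, obtained from `𝓡₁(p)` by exchanging
the roles of the two users. -/
def Region2 : Set (ℝ × ℝ) :=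
  {r | 0 ≤ r.1 ∧ 0 ≤ r.2 ∧
    (r.2 ≤ condMutInfo (jointP pQ pX1 pX2 W) vX2 vY2 vQ ∨
      (r.1 ≤ condMutInfo (jointP pQ pX1 pX2 W) vX1 vY2 (fun z => (vX2 z, vQ z)) ∧
        r.1 + r.2 ≤ condMutInfo (jointP pQ pX1 pX2 W) (fun z => (vX1 z, vX2 z)) vY2 vQ))}

/-- A codebook for the two-user interference channel: a time-sharing sequence together with
a codeword for each message of each sender. -/
abbrev Codebook (Q X1 X2 : Type*) (n M1 M2 : ℕ) : Type _ :=
  (Fin n → Q) × (Fin M1 → Fin n → X1) × (Fin M2 → Fin n → X2)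

/-- The probability of a codebook under the `p`-distributed random code ensemble. -/
def ensembleP {n M1 M2 : ℕ} (c : Codebook Q X1 X2 n M1 M2) : ℝ :=
  (∏ i, pQ (c.1 i)) * (∏ m1, ∏ i, pX1 (c.1 i) (c.2.1 m1 i)) *
    (∏ m2, ∏ i, pX2 (c.1 i) (c.2.2 m2 i))

/-- The average probability of error of the code given by codebook `c` and decoders
`d1`, `d2` (messages are uniform, the channel is memoryless). -/
def PeCode {n M1 M2 : ℕ} (c : Codebook Q X1 X2 n M1 M2)
    (d1 : (Fin n → Y1) → Fin M1) (d2 : (Fin n → Y2) → Fin M2) : ℝ :=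
  ((M1 : ℝ) * (M2 : ℝ))⁻¹ * ∑ m1, ∑ m2, ∑ y1 : Fin n → Y1, ∑ y2 : Fin n → Y2,
    (∏ i, W (c.2.1 m1 i) (c.2.2 m2 i) (y1 i, y2 i)) *
      (if d1 y1 = m1 ∧ d2 y2 = m2 then 0 else 1)

/-- The probability of error of the codebook `c` under optimal (maximum likelihood)
decoding, i.e. the least error probability over all decoder pairs. -/
def PeOpt {n M1 M2 : ℕ} (c : Codebook Q X1 X2 n M1 M2) : ℝ :=
  ⨅ d : ((Fin n → Y1) → Fin M1) × ((Fin n → Y2) → Fin M2), PeCode W c d.1 d.2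

/-- The probability of error under optimal decoding at blocklength `n` and rates `(R1, R2)`,
averaged over the random code ensemble. -/
def avgPeOpt (R1 R2 : ℝ) (n : ℕ) : ℝ :=
  ∑ c : Codebook Q X1 X2 n (msgSize n R1) (msgSize n R2),
    ensembleP pQ pX1 pX2 c * PeOpt W c

set_option linter.unusedSectionVars false

theorem sum_pi_prod {ι S : Type*} [Fintype ι] [DecidableEq ι] [Fintype S] (f : ι → S → ℝ) :
    ∑ s : ι → S, ∏ i, f i (s i) = ∏ i, ∑ x, f i x := by
  rw [Finset.prod_univ_sum, Fintype.piFinset_univ]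

theorem IsPMF.pi {ι S : Type*} [Fintype ι] [DecidableEq ι] [Fintype S] {f : ι → S → ℝ}
    (hf : ∀ i, IsPMF (f i)) : IsPMF fun s : ι → S => ∏ i, f i (s i) :=
  ⟨fun s => Finset.prod_nonneg fun i _ => (hf i).1 _, by
    rw [sum_pi_prod]; exact Finset.prod_eq_one fun i _ => (hf i).2⟩

/-- Singling out one coordinate of an i.i.d. family. -/
theorem sum_pi_prod_split {ι S : Type*} [Fintype ι] [DecidableEq ι] [Fintype S]
    (α : S → ℝ) (i : ι) (φ : S → ({j // j ≠ i} → S) → ℝ) :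
    ∑ s : ι → S, (∏ j, α (s j)) * φ (s i) (fun j => s j) =
      ∑ x, α x * ∑ t : {j // j ≠ i} → S, (∏ j, α (t j)) * φ x t := by
  rw [← (Equiv.funSplitAt i S).symm.sum_comp, Fintype.sum_prod_type]
  refine Finset.sum_congr rfl fun x _ => ?_
  rw [Finset.mul_sum]
  refine Finset.sum_congr rfl fun t _ => ?_
  have h : ∀ j : {j // j ≠ i}, (Equiv.funSplitAt i S).symm (x, t) j = t j := fun j => by
    simp [Equiv.funSplitAt, Equiv.piSplitAt, j.2]
  rw [Fintype.prod_eq_mul_prod_subtype_ne _ i]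
  simp only [h]
  simp [Equiv.funSplitAt, Equiv.piSplitAt, mul_assoc]

theorem sum_pi_prod_marginal {ι S : Type*} [Fintype ι] [DecidableEq ι] [Fintype S]
    {α : S → ℝ} (hα : IsPMF α) (i : ι) (φ : S → ℝ) :
    ∑ s : ι → S, (∏ j, α (s j)) * φ (s i) = ∑ x, α x * φ x := by
  rw [sum_pi_prod_split α i fun x _ => φ x]
  refine Finset.sum_congr rfl fun x _ => ?_
  rw [← Finset.sum_mul, (IsPMF.pi fun _ : {j // j ≠ i} => hα).2, one_mul]

theorem sum_pi_prod_marginal_pair {ι S : Type*} [Fintype ι] [DecidableEq ι] [Fintype S]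
    {α : S → ℝ} (hα : IsPMF α) {i k : ι} (hk : k ≠ i) (φ : S → S → ℝ) :
    ∑ s : ι → S, (∏ j, α (s j)) * φ (s i) (s k) = ∑ x, α x * ∑ y, α y * φ x y := by
  rw [sum_pi_prod_split α i fun x t => φ x (t ⟨k, hk⟩)]
  refine Finset.sum_congr rfl fun x _ => ?_
  rw [sum_pi_prod_marginal hα]

/-- Fano's inequality combined with Gibbs' inequality for the output distribution. -/
theorem fano_gibbs {ι Y : Type*} [Fintype ι] [Nonempty ι] [DecidableEq ι] [Fintype Y]
    {U : ι → Y → ℝ} (hU : ∀ m, IsPMF (U m)) {r : Y → ℝ} (hr : IsPMF r)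
    (hac : ∀ m y, 0 < U m y → 0 < r y) (d : Y → ι) :
    ∑ m, ∑ y, U m y * (Real.log (Fintype.card ι) + Real.log (r y) - Real.log (U m y)
      - Real.log 2 - (if d y = m then 0 else 1) * Real.log (Fintype.card ι)) ≤ 0 := by
  set M : ℝ := (Fintype.card ι : ℝ) with hM
  have hM1 : (1 : ℝ) ≤ M := by rw [hM]; exact_mod_cast Fintype.card_pos
  have hM0 : 0 < M := by linarith
  have key : ∀ m y, U m y * (Real.log M + Real.log (r y) - Real.log (U m y)
      - Real.log 2 - (if d y = m then 0 else 1) * Real.log M) ≤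
      r y * ((if d y = m then M / 2 else 0) + 1 / 2) - U m y := by
    intro m y
    have hr0 := hr.1 y
    rcases ((hU m).1 y).eq_or_lt with h0 | hpos
    · rw [← h0]
      have : 0 ≤ (if d y = m then M / 2 else 0) + 1 / 2 := by split_ifs <;> positivity
      simp only [zero_mul, sub_zero]
      positivity
    have hr1 := hac m y hpos
    by_cases hd : d y = m
    · simp only [hd, if_true, zero_mul, sub_zero]
      have hlog : Real.log M + Real.log (r y) - Real.log (U m y) - Real.log 2 =
          Real.log (M * r y / U m y / 2) := by
        rw [Real.log_div (by positivity) (by norm_num), Real.log_div (by positivity) hpos.ne',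
          Real.log_mul hM0.ne' hr1.ne']
      rw [hlog]
      have h := Real.log_le_sub_one_of_pos (show 0 < M * r y / U m y / 2 by positivity)
      calc _ ≤ U m y * (M * r y / U m y / 2 - 1) := by gcongr
        _ = r y * (M / 2) - U m y := by field_simp
        _ ≤ _ := by linarith
    · simp only [hd, if_false, one_mul]
      have hlog : Real.log M + Real.log (r y) - Real.log (U m y) - Real.log 2 - Real.log M =
          Real.log (r y / U m y / 2) := by
        rw [Real.log_div (by positivity) (by norm_num), Real.log_div (by positivity) hpos.ne']
        ring
      rw [hlog]
      have h := Real.log_le_sub_one_of_pos (show 0 < r y / U m y / 2 by positivity)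
      calc _ ≤ U m y * (r y / U m y / 2 - 1) := by gcongr
        _ = r y * (0 + 1 / 2) - U m y := by field_simp; ring
  calc _ ≤ ∑ m, ∑ y, (r y * ((if d y = m then M / 2 else 0) + 1 / 2) - U m y) :=
        Finset.sum_le_sum fun m _ => Finset.sum_le_sum fun y _ => key m y
    _ = 0 := by
      simp only [Finset.sum_sub_distrib, (hU _).2]
      rw [Finset.sum_comm]
      simp only [← Finset.mul_sum, Finset.sum_add_distrib, Finset.sum_ite_eq, Finset.mem_univ,
        if_true, Finset.sum_const, Finset.card_univ, nsmul_eq_mul, ← hM]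
      rw [← Finset.sum_mul, hr.2]
      ring

/-- Jensen's bound on the entropy of the output mixture of a random code. -/
theorem sum_mixture_log_le {κ B Y : Type*} [Fintype κ] [Nonempty κ] [DecidableEq κ] [Fintype B]
    [Fintype Y] {β : B → ℝ} (hβ : IsPMF β) {V : B → Y → ℝ} (hV : ∀ b, IsPMF (V b)) :
    ∑ s : κ → B, (∏ j, β (s j)) * ∑ y, ((Fintype.card κ : ℝ)⁻¹ * ∑ k, V (s k) y) *
        Real.log ((Fintype.card κ : ℝ)⁻¹ * ∑ k, V (s k) y) ≤
      ∑ b, β b * ∑ y, V b y *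
        Real.log ((Fintype.card κ : ℝ)⁻¹ * V b y + ∑ b', β b' * V b' y) := by
  set M : ℝ := (Fintype.card κ : ℝ) with hM
  have hM1 : (1 : ℝ) ≤ M := by rw [hM]; exact_mod_cast Fintype.card_pos
  have hM0 : 0 < M := by linarith
  set r : Y → ℝ := fun y => ∑ b', β b' * V b' y with hr
  have hr0 : ∀ y, 0 ≤ r y := fun y => Finset.sum_nonneg fun b _ => mul_nonneg (hβ.1 b) ((hV b).1 y)
  set G : B → Y → ℝ := fun b y => M⁻¹ * V b y + r y with hG
  have hG0 : ∀ b y, 0 ≤ G b y := fun b y =>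
    add_nonneg (mul_nonneg (by positivity) ((hV b).1 y)) (hr0 y)
  have hs0 : ∀ s : κ → B, 0 ≤ ∏ j, β (s j) := fun s => Finset.prod_nonneg fun j _ => hβ.1 _
  -- the pointwise bound `log t ≤ t - 1`
  have key : ∀ (s : κ → B) k y, V (s k) y * Real.log (M⁻¹ * ∑ k', V (s k') y) ≤
      V (s k) y * Real.log (G (s k) y) +
        (M⁻¹ * ∑ k', V (s k) y / G (s k) y * V (s k') y) - V (s k) y := by
    intro s k y
    rcases ((hV (s k)).1 y).eq_or_lt with h0 | hpos
    · simp [← h0]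
    have hU : 0 < M⁻¹ * ∑ k', V (s k') y :=
      mul_pos (by positivity) (lt_of_lt_of_le hpos
        (Finset.single_le_sum (f := fun k' => V (s k') y) (fun k' _ => (hV _).1 y)
          (Finset.mem_univ k)))
    have hGp : 0 < G (s k) y := by
      have : 0 < M⁻¹ * V (s k) y := by positivity
      have := hr0 y
      simp only [hG]; linarith
    have h := Real.log_le_sub_one_of_pos (div_pos hU hGp)
    rw [Real.log_div hU.ne' hGp.ne'] at h
    have h2 := mul_le_mul_of_nonneg_left h hpos.le
    rw [← Finset.mul_sum]
    have h3 : V (s k) y * ((M⁻¹ * ∑ k', V (s k') y) / G (s k) y - 1) =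
      M⁻¹ * (V (s k) y / G (s k) y * ∑ k', V (s k') y) - V (s k) y := by ring
    linarith
  have marg : ∀ k y, ∑ s : κ → B, (∏ j, β (s j)) * V (s k) y = r y := fun k y =>
    sum_pi_prod_marginal hβ k fun b => V b y
  have cross : ∀ k y, ∑ s : κ → B, (∏ j, β (s j)) *
      (M⁻¹ * ∑ k', V (s k) y / G (s k) y * V (s k') y) ≤ r y := by
    intro k y
    have hk : ∀ k', ∑ s : κ → B, (∏ j, β (s j)) * (V (s k) y / G (s k) y * V (s k') y) ≤
        ∑ b, β b * (V b y / G b y * (r y + if k' = k then V b y else 0)) := by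
      intro k'
      by_cases h : k' = k
      · subst h
        rw [sum_pi_prod_marginal hβ k' fun b => V b y / G b y * V b y]
        refine Finset.sum_le_sum fun b _ => mul_le_mul_of_nonneg_left ?_ (hβ.1 b)
        refine mul_le_mul_of_nonneg_left ?_ (div_nonneg ((hV b).1 y) (hG0 b y))
        simpa using hr0 y
      · rw [sum_pi_prod_marginal_pair hβ h fun b b' => V b y / G b y * V b' y]
        refine (Finset.sum_congr rfl fun b _ => ?_).le
        simp only [h, if_false, add_zero, hr, Finset.mul_sum]
        refine Finset.sum_congr rfl fun b' _ => by ring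
    calc _ = M⁻¹ * ∑ k', ∑ s : κ → B, (∏ j, β (s j)) *
              (V (s k) y / G (s k) y * V (s k') y) := by
          rw [Finset.sum_comm, Finset.mul_sum]
          refine Finset.sum_congr rfl fun s _ => ?_
          simp only [Finset.mul_sum]
          exact Finset.sum_congr rfl fun k' _ => by ring
      _ ≤ M⁻¹ * ∑ k', ∑ b, β b * (V b y / G b y * (r y + if k' = k then V b y else 0)) := by
          gcongr with k'
          exact hk k'
      _ = ∑ b, β b * (V b y / G b y * G b y) := by
          rw [Finset.sum_comm, Finset.mul_sum]
          refine Finset.sum_congr rfl fun b _ => ?_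
          simp only [← Finset.mul_sum, Finset.sum_add_distrib, Finset.sum_ite_eq', Finset.mem_univ,
            if_true, Finset.sum_const, Finset.card_univ, nsmul_eq_mul, ← hM]
          simp only [hG]
          field_simp
          ring
      _ ≤ r y := by
          refine Finset.sum_le_sum fun b _ => mul_le_mul_of_nonneg_left ?_ (hβ.1 b)
          rcases (hG0 b y).eq_or_lt with h0 | hpos
          · simpa [← h0] using (hV b).1 y
          · exact (div_mul_cancel₀ _ hpos.ne').le
  have bound : ∀ k y, ∑ s : κ → B, (∏ j, β (s j)) *
      (V (s k) y * Real.log (M⁻¹ * ∑ k', V (s k') y)) ≤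
        ∑ b, β b * (V b y * Real.log (G b y)) := by
    intro k y
    calc _ ≤ ∑ s : κ → B, (∏ j, β (s j)) * (V (s k) y * Real.log (G (s k) y) +
        (M⁻¹ * ∑ k', V (s k) y / G (s k) y * V (s k') y) - V (s k) y) :=
          Finset.sum_le_sum fun s _ => mul_le_mul_of_nonneg_left (key s k y) (hs0 s)
      _ ≤ _ := by
          simp only [mul_sub, mul_add, Finset.sum_sub_distrib, Finset.sum_add_distrib, marg]
          rw [sum_pi_prod_marginal hβ k fun b => V b y * Real.log (G b y)]
          linarith [cross k y]
  calc _ = M⁻¹ * ∑ k, ∑ y, ∑ s : κ → B, (∏ j, β (s j)) *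
        (V (s k) y * Real.log (M⁻¹ * ∑ k', V (s k') y)) := by
        simp only [Finset.sum_comm (s := (Finset.univ : Finset Y)) (t := (Finset.univ : Finset (κ → B))),
          ← Finset.mul_sum]
        rw [Finset.sum_comm, Finset.mul_sum]
        refine Finset.sum_congr rfl fun s _ => ?_
        rw [← Finset.mul_sum, Finset.sum_comm, mul_left_comm, Finset.mul_sum (a := M⁻¹)]
        congr 1
        refine Finset.sum_congr rfl fun y _ => ?_
        rw [mul_assoc, Finset.sum_mul]
    _ ≤ M⁻¹ * ∑ k : κ, ∑ y, ∑ b, β b * (V b y * Real.log (G b y)) := by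
        gcongr with k _ y
        exact bound k y
    _ = _ := by
        rw [Finset.sum_const, Finset.card_univ, nsmul_eq_mul, ← hM, inv_mul_cancel_left₀ hM0.ne',
          Finset.sum_comm]
        simp only [← Finset.mul_sum]
        rfl

theorem sum_pi_prod_sum_marginal {ι S : Type*} [Fintype ι] [DecidableEq ι] [Fintype S]
    {α : S → ℝ} (hα : IsPMF α) (φ : S → ℝ) :
    ∑ s : ι → S, (∏ j, α (s j)) * ∑ i, φ (s i) = Fintype.card ι * ∑ x, α x * φ x := by
  simp only [Finset.mul_sum (s := (Finset.univ : Finset ι))]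
  rw [Finset.sum_comm]
  simp only [sum_pi_prod_marginal hα, Finset.sum_const, Finset.card_univ, nsmul_eq_mul]

/-- One-shot converse for a random code with a fixed time-sharing symbol. -/
theorem one_shot_converse {ι κ A B Y : Type*} [Fintype ι] [Nonempty ι] [DecidableEq ι]
    [Fintype κ] [Nonempty κ] [DecidableEq κ] [Fintype A] [Fintype B] [Fintype Y]
    {α : A → ℝ} (hα : IsPMF α) {β : B → ℝ} (hβ : IsPMF β)
    {V : A → B → Y → ℝ} (hV : ∀ a b, IsPMF (V a b)) (d : (ι → A) → (κ → B) → Y → ι) :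
    Real.log (Fintype.card ι) + ∑ a, α a * ∑ b, β b * ∑ y, V a b y *
        (Real.log (∑ a', α a' * ∑ b', β b' * V a' b' y) -
          Real.log ((Fintype.card κ : ℝ)⁻¹ * V a b y + ∑ b', β b' * V a b' y)) ≤
      Real.log 2 + Real.log (Fintype.card ι) *
        ∑ s : ι → A, (∏ i, α (s i)) * ∑ t : κ → B, (∏ k, β (t k)) *
          (((Fintype.card ι : ℝ) * (Fintype.card κ : ℝ))⁻¹ * ∑ m, ∑ k, ∑ y,
            V (s m) (t k) y * (if d s t y = m then 0 else 1)) := by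
  set M : ℝ := (Fintype.card ι : ℝ) with hM
  set N : ℝ := (Fintype.card κ : ℝ) with hN
  have hM1 : (1 : ℝ) ≤ M := by rw [hM]; exact_mod_cast Fintype.card_pos
  have hN1 : (1 : ℝ) ≤ N := by rw [hN]; exact_mod_cast Fintype.card_pos
  have hM0 : 0 < M := by linarith
  have hN0 : 0 < N := by linarith
  set r : Y → ℝ := fun y => ∑ a', α a' * ∑ b', β b' * V a' b' y with hr
  set G : A → B → Y → ℝ := fun a b y => N⁻¹ * V a b y + ∑ b', β b' * V a b' y with hG
  have hin : ∀ a y, 0 ≤ ∑ b', β b' * V a b' y := fun a y =>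
    Finset.sum_nonneg fun b _ => mul_nonneg (hβ.1 b) ((hV a b).1 y)
  have hrP : IsPMF r := by
    refine ⟨fun y => Finset.sum_nonneg fun a _ => mul_nonneg (hα.1 a) (hin a y), ?_⟩
    simp only [hr]
    rw [Finset.sum_comm]
    simp only [← Finset.mul_sum]
    rw [← hα.2]
    refine Finset.sum_congr rfl fun a _ => ?_
    rw [Finset.sum_comm]
    simp only [← Finset.mul_sum, (hV a _).2, mul_one, hβ.2]
  set U : (κ → B) → A → Y → ℝ := fun t a y => N⁻¹ * ∑ k, V a (t k) y with hUdef
  have hU : ∀ t a, IsPMF (U t a) := by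
    intro t a
    refine ⟨fun y => mul_nonneg (by positivity) (Finset.sum_nonneg fun k _ => (hV _ _).1 y), ?_⟩
    simp only [hUdef]
    rw [← Finset.mul_sum, Finset.sum_comm]
    simp only [(hV a _).2, Finset.sum_const, Finset.card_univ, nsmul_eq_mul, mul_one, ← hN]
    exact inv_mul_cancel₀ hN0.ne'
  have hs0 : ∀ s : ι → A, 0 ≤ ∏ j, α (s j) := fun s => Finset.prod_nonneg fun j _ => hα.1 _
  have ht0 : ∀ t : κ → B, 0 ≤ ∏ j, β (t j) := fun t => Finset.prod_nonneg fun j _ => hβ.1 _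
  have fano : ∀ (s : ι → A) (t : κ → B), (∏ i, α (s i)) * ((∏ k, β (t k)) *
      ∑ m, ∑ y, U t (s m) y * (Real.log M + Real.log (r y) - Real.log (U t (s m) y)
      - Real.log 2 - (if d s t y = m then 0 else 1) * Real.log M)) ≤ 0 := by
    intro s t
    rcases (hs0 s).eq_or_lt with h0 | hsp
    · simp [← h0]
    rcases (ht0 t).eq_or_lt with h0 | htp
    · simp [← h0]
    refine mul_nonpos_of_nonneg_of_nonpos hsp.le (mul_nonpos_of_nonneg_of_nonpos htp.le ?_)
    refine fano_gibbs (fun m => hU t (s m)) hrP (fun m y hpos => ?_) (d s t)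
    have hα' : 0 < α (s m) := lt_of_le_of_ne (hα.1 _) fun h =>
      hsp.ne' (Finset.prod_eq_zero (Finset.mem_univ m) h.symm)
    have hsum : 0 < ∑ k, V (s m) (t k) y := by
      simp only [hUdef] at hpos
      exact (pos_iff_pos_of_mul_pos hpos).1 (by positivity)
    obtain ⟨k, -, hk⟩ := Finset.exists_ne_zero_of_sum_ne_zero hsum.ne'
    have hk' : 0 < V (s m) (t k) y := lt_of_le_of_ne ((hV _ _).1 y) hk.symm
    have hβ' : 0 < β (t k) := lt_of_le_of_ne (hβ.1 _) fun h =>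
      htp.ne' (Finset.prod_eq_zero (Finset.mem_univ k) h.symm)
    refine lt_of_lt_of_le (mul_pos hα' (lt_of_lt_of_le (mul_pos hβ' hk') ?_))
      (Finset.single_le_sum (f := fun a => α a * ∑ b', β b' * V a b' y)
        (fun a _ => mul_nonneg (hα.1 a) (hin a y)) (Finset.mem_univ (s m)))
    exact Finset.single_le_sum (f := fun b => β b * V (s m) b y)
      (fun b _ => mul_nonneg (hβ.1 b) ((hV _ _).1 y)) (Finset.mem_univ (t k))
  have total : ∑ s : ι → A, ∑ t : κ → B, (∏ i, α (s i)) * ((∏ k, β (t k)) *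
      ∑ m, ∑ y, U t (s m) y * (Real.log M + Real.log (r y) - Real.log (U t (s m) y)
      - Real.log 2 - (if d s t y = m then 0 else 1) * Real.log M)) ≤ 0 :=
    Finset.sum_nonpos fun s _ => Finset.sum_nonpos fun t _ => fano s t
  have expand : ∀ (s : ι → A) (t : κ → B),
      ∑ m, ∑ y, U t (s m) y * (Real.log M + Real.log (r y) - Real.log (U t (s m) y)
      - Real.log 2 - (if d s t y = m then 0 else 1) * Real.log M) =
      M * (Real.log M - Real.log 2) + ∑ m, ∑ y, U t (s m) y * Real.log (r y)
      - ∑ m, ∑ y, U t (s m) y * Real.log (U t (s m) y)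
      - Real.log M * M * ((M * N)⁻¹ * ∑ m, ∑ k, ∑ y,
            V (s m) (t k) y * (if d s t y = m then 0 else 1)) := by
    intro s t
    have h1 : M * (Real.log M - Real.log 2) =
        ∑ m, ∑ y, U t (s m) y * (Real.log M - Real.log 2) := by
      simp only [← Finset.sum_mul, (hU t _).2, Finset.sum_const, Finset.card_univ, nsmul_eq_mul,
        mul_one, ← hM]
    have h2 : Real.log M * M * ((M * N)⁻¹ * ∑ m, ∑ k, ∑ y,
            V (s m) (t k) y * (if d s t y = m then 0 else 1)) =
        ∑ m, ∑ y, U t (s m) y * ((if d s t y = m then 0 else 1) * Real.log M) := by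
      have : ∀ x : ℝ, Real.log M * M * ((M * N)⁻¹ * x) = (N⁻¹ * Real.log M) * x := fun x => by
        field_simp
      rw [this, Finset.mul_sum]
      refine Finset.sum_congr rfl fun m _ => ?_
      rw [Finset.sum_comm, Finset.mul_sum]
      refine Finset.sum_congr rfl fun y _ => ?_
      simp only [hUdef]
      rw [← Finset.sum_mul]
      ring
    rw [h1, h2]
    simp only [← Finset.sum_sub_distrib, ← Finset.sum_add_distrib]
    refine Finset.sum_congr rfl fun m _ => Finset.sum_congr rfl fun y _ => by ring
  have hr_term : ∑ s : ι → A, ∑ t : κ → B, (∏ i, α (s i)) * ((∏ k, β (t k)) *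
      ∑ m, ∑ y, U t (s m) y * Real.log (r y)) =
      M * ∑ a, α a * ∑ b, β b * ∑ y, V a b y * Real.log (r y) := by
    have inner : ∀ a, ∑ t : κ → B, (∏ k, β (t k)) * ∑ y, U t a y * Real.log (r y) =
        ∑ b, β b * ∑ y, V a b y * Real.log (r y) := by
      intro a
      have h := sum_pi_prod_sum_marginal (ι := κ) hβ fun b => ∑ y, V a b y * Real.log (r y)
      rw [← hN] at h
      rw [← inv_mul_cancel_left₀ hN0.ne' (∑ b, β b * ∑ y, V a b y * Real.log (r y)), ← h,
        Finset.mul_sum]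
      refine Finset.sum_congr rfl fun t _ => ?_
      rw [Finset.sum_comm, mul_left_comm, Finset.mul_sum (a := N⁻¹)]
      congr 1
      refine Finset.sum_congr rfl fun y _ => ?_
      simp only [hUdef]
      rw [← Finset.sum_mul, mul_assoc]
    rw [← Finset.sum_congr rfl fun a _ => congrArg (α a * ·) (inner a), hM,
      ← sum_pi_prod_sum_marginal (ι := ι) hα]
    refine Finset.sum_congr rfl fun s _ => ?_
    rw [← Finset.mul_sum, Finset.sum_comm]
    simp only [Finset.mul_sum (s := (Finset.univ : Finset ι))]
  have hU_term : ∑ s : ι → A, ∑ t : κ → B, (∏ i, α (s i)) * ((∏ k, β (t k)) *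
      ∑ m, ∑ y, U t (s m) y * Real.log (U t (s m) y)) ≤
      M * ∑ a, α a * ∑ b, β b * ∑ y, V a b y * Real.log (G a b y) := by
    calc _ = M * ∑ a, α a * ∑ t : κ → B, (∏ k, β (t k)) *
          ∑ y, U t a y * Real.log (U t a y) := by
          rw [hM, ← sum_pi_prod_sum_marginal (ι := ι) hα]
          refine Finset.sum_congr rfl fun s _ => ?_
          rw [← Finset.mul_sum, Finset.sum_comm]
          simp only [Finset.mul_sum (s := (Finset.univ : Finset ι))]
      _ ≤ _ := by
          refine mul_le_mul_of_nonneg_left (Finset.sum_le_sum fun a _ =>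
            mul_le_mul_of_nonneg_left ?_ (hα.1 a)) hM0.le
          exact sum_mixture_log_le hβ (hV a)
  have lin : ∀ (c k : ℝ) (F F' D : (ι → A) → (κ → B) → ℝ),
      ∑ s : ι → A, ∑ t : κ → B, (∏ i, α (s i)) * ((∏ k, β (t k)) *
        (c + F s t - F' s t - k * D s t)) =
      c + ∑ s : ι → A, ∑ t : κ → B, (∏ i, α (s i)) * ((∏ k, β (t k)) * F s t)
      - ∑ s : ι → A, ∑ t : κ → B, (∏ i, α (s i)) * ((∏ k, β (t k)) * F' s t)
      - k * ∑ s : ι → A, (∏ i, α (s i)) * ∑ t : κ → B, (∏ k, β (t k)) * D s t := by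
    intro c k F F' D
    have hc : c = ∑ s : ι → A, ∑ t : κ → B, (∏ i, α (s i)) * ((∏ k, β (t k)) * c) := by
      simp only [← Finset.mul_sum, ← Finset.sum_mul]
      rw [(IsPMF.pi fun _ : κ => hβ).2, (IsPMF.pi fun _ : ι => hα).2, one_mul, one_mul]
    have hk : k * ∑ s : ι → A, (∏ i, α (s i)) * ∑ t : κ → B, (∏ k, β (t k)) * D s t =
        ∑ s : ι → A, ∑ t : κ → B, (∏ i, α (s i)) * ((∏ k, β (t k)) * (k * D s t)) := by
      simp only [Finset.mul_sum]
      exact Finset.sum_congr rfl fun s _ => Finset.sum_congr rfl fun t _ => by ring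
    rw [hk]
    nth_rewrite 2 [hc]
    simp only [← Finset.sum_sub_distrib, ← Finset.sum_add_distrib]
    exact Finset.sum_congr rfl fun s _ => Finset.sum_congr rfl fun t _ => by ring
  simp only [expand] at total
  rw [lin, hr_term] at total
  simp only [mul_sub, Finset.sum_sub_distrib]
  refine le_of_mul_le_mul_left ?_ hM0
  linarith

theorem sum_pi_succ {Z : Type*} [Fintype Z] (n : ℕ) (F : (Fin (n + 1) → Z) → ℝ) :
    ∑ z, F z = ∑ x, ∑ z : Fin n → Z, F (Fin.cons x z) := by
  rw [← (Fin.consEquiv fun _ : Fin (n + 1) => Z).sum_comp, Fintype.sum_prod_type]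
  rfl

theorem sum_pi_prod_mul_sum {Z : Type*} [Fintype Z] {P : Z → ℝ} (hP : IsPMF P) {g : Z → ℝ}
    (hg : ∑ x, P x * g x = 0) (n : ℕ) :
    ∑ z : Fin n → Z, (∏ i, P (z i)) * ∑ i, g (z i) = 0 := by
  rw [sum_pi_prod_sum_marginal hP, hg, mul_zero]

theorem sum_pi_prod_mul_sum_sq {Z : Type*} [Fintype Z] {P : Z → ℝ} (hP : IsPMF P) {g : Z → ℝ}
    (hg : ∑ x, P x * g x = 0) (n : ℕ) :
    ∑ z : Fin n → Z, (∏ i, P (z i)) * (∑ i, g (z i)) ^ 2 = n * ∑ x, P x * g x ^ 2 := by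
  induction n with
  | zero => simp
  | succ n ih =>
    rw [sum_pi_succ]
    simp only [Fin.prod_univ_succ, Fin.sum_univ_succ, Fin.cons_zero, Fin.cons_succ]
    have h : ∀ x, ∑ z : Fin n → Z, P x * (∏ i, P (z i)) * (g x + ∑ i, g (z i)) ^ 2 =
        P x * g x ^ 2 + P x * (n * ∑ x, P x * g x ^ 2) := by
      intro x
      have e : ∀ z : Fin n → Z, P x * (∏ i, P (z i)) * (g x + ∑ i, g (z i)) ^ 2 =
          P x * g x ^ 2 * (∏ i, P (z i)) + 2 * P x * g x * ((∏ i, P (z i)) * ∑ i, g (z i)) +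
            P x * ((∏ i, P (z i)) * (∑ i, g (z i)) ^ 2) := fun z => by ring
      simp only [e, Finset.sum_add_distrib, ← Finset.mul_sum]
      rw [ih, sum_pi_prod_mul_sum hP hg, (IsPMF.pi fun _ : Fin n => hP).2]
      ring
    simp only [h, Finset.sum_add_distrib, ← Finset.sum_mul, hP.2]
    push_cast
    ring

/-- A quantitative weak law of large numbers. -/
theorem exists_mean_abs_deviation_le {Z : Type*} [Fintype Z] {P : Z → ℝ} (hP : IsPMF P)
    (g : Z → ℝ) : ∃ K : ℝ, ∀ n : ℕ,
      ∑ z : Fin n → Z, (∏ i, P (z i)) * |∑ i, g (z i) - n * ∑ x, P x * g x| ≤ K * √n := by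
  set μ := ∑ x, P x * g x with hμ
  have hg : ∑ x, P x * (g x - μ) = 0 := by
    simp only [mul_sub, Finset.sum_sub_distrib, ← Finset.sum_mul, hP.2, ← hμ]
    ring
  refine ⟨((∑ x, P x * (g x - μ) ^ 2) + 1) / 2, fun n => ?_⟩
  rcases n.eq_zero_or_pos with rfl | hn
  · simp
  have hn0 : (0 : ℝ) < √n := by positivity
  have hsq : √(n : ℝ) * √n = n := Real.mul_self_sqrt (by positivity)
  have pt : ∀ z : Fin n → Z, |∑ i, g (z i) - n * μ| ≤
      (∑ i, (g (z i) - μ)) ^ 2 * (2 * √n)⁻¹ + √n / 2 := by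
    intro z
    have e : ∑ i, g (z i) - n * μ = ∑ i, (g (z i) - μ) := by simp
    rw [e, ← sq_abs (∑ i, (g (z i) - μ))]
    set t := |∑ i, (g (z i) - μ)|
    have e2 : t ^ 2 * (2 * √n)⁻¹ + √n / 2 - t = (t - √n) ^ 2 * (2 * √n)⁻¹ := by
      field_simp
      ring
    have : 0 ≤ (t - √n) ^ 2 * (2 * √n)⁻¹ := by positivity
    linarith
  calc _ ≤ ∑ z : Fin n → Z, (∏ i, P (z i)) *
        ((∑ i, (g (z i) - μ)) ^ 2 * (2 * √n)⁻¹ + √n / 2) :=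
        Finset.sum_le_sum fun z _ => mul_le_mul_of_nonneg_left (pt z)
          ((IsPMF.pi fun _ : Fin n => hP).1 z)
    _ = n * (∑ x, P x * (g x - μ) ^ 2) * (2 * √n)⁻¹ + √n / 2 := by
        simp only [mul_add, Finset.sum_add_distrib, ← mul_assoc, ← Finset.sum_mul]
        rw [sum_pi_prod_mul_sum_sq hP hg, (IsPMF.pi fun _ : Fin n => hP).2]
        ring
    _ = _ := by
        nth_rewrite 1 [← hsq]
        field_simp

theorem sum_arrow_prod {ι S T : Type*} [Fintype ι] [DecidableEq ι] [Fintype S] [Fintype T]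
    (F : (ι → S × T) → ℝ) :
    ∑ z, F z = ∑ s : ι → S, ∑ t : ι → T, F fun i => (s i, t i) := by
  rw [← (Equiv.arrowProdEquivProdArrow ι (fun _ => S) (fun _ => T)).symm.sum_comp,
    Fintype.sum_prod_type]
  rfl

theorem log_add_le_log_two_add_max {x y : ℝ} (hx : 0 < x) (hy : 0 < y) :
    Real.log (x + y) ≤ Real.log 2 + max (Real.log x) (Real.log y) := by
  have h : x + y ≤ 2 * max x y := by linarith [le_max_left x y, le_max_right x y]
  have hm : 0 < max x y := lt_max_of_lt_left hx
  calc _ ≤ Real.log (2 * max x y) := Real.log_le_log (by positivity) h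
    _ = Real.log 2 + Real.log (max x y) := Real.log_mul two_ne_zero hm.ne'
    _ ≤ _ := by
      rcases max_choice x y with h | h <;> rw [h] <;> simp

section Block

variable {𝒬 A B Y : Type*} [Fintype B]

/-- The conditional law of the output given the time-sharing symbol and the first input. -/
def outA (pB : 𝒬 → B → ℝ) (V : A → B → Y → ℝ) (q : 𝒬) (a : A) (y : Y) : ℝ :=
  ∑ b, pB q b * V a b y

theorem sum_block_outA {n : ℕ} {pB : 𝒬 → B → ℝ} {V : A → B → Y → ℝ} (q : Fin n → 𝒬) (a : Fin n → A) 
    (y : Fin n → Y) :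
    ∑ b : Fin n → B, (∏ i, pB (q i) (b i)) * ∏ i, V (a i) (b i) (y i) =
      ∏ i, outA pB V (q i) (a i) (y i) := by
  simp only [← Finset.prod_mul_distrib, outA, Fintype.prod_sum]

theorem outA_pos {pB : 𝒬 → B → ℝ} {V : A → B → Y → ℝ} [Fintype Y] (hB : ∀ q, IsPMF (pB q))
    (hV : ∀ a b, IsPMF (V a b)) {q : 𝒬} {a : A} {b : B} {y : Y} (hb : 0 < pB q b)
    (hy : 0 < V a b y) : 0 < outA pB V q a y :=
  lt_of_lt_of_le (mul_pos hb hy) (Finset.single_le_sum (f := fun b => pB q b * V a b y)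
    (fun b _ => mul_nonneg ((hB q).1 b) ((hV a b).1 y)) (Finset.mem_univ b))

variable [Fintype A]

/-- The conditional law of the output given the time-sharing symbol. -/
def outQ (pA : 𝒬 → A → ℝ) (pB : 𝒬 → B → ℝ) (V : A → B → Y → ℝ) (q : 𝒬) (y : Y) : ℝ :=
  outA pA (outA pB V) q q y

variable [Fintype Y] {pA : 𝒬 → A → ℝ} {pB : 𝒬 → B → ℝ} {V : A → B → Y → ℝ}

theorem outQ_pos (hA : ∀ q, IsPMF (pA q)) (hB : ∀ q, IsPMF (pB q)) (hV : ∀ a b, IsPMF (V a b))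
    {q : 𝒬} {a : A} {b : B} {y : Y} (ha : 0 < pA q a) (hb : 0 < pB q b) (hy : 0 < V a b y) :
    0 < outQ pA pB V q y :=
  lt_of_lt_of_le (mul_pos ha (outA_pos hB hV hb hy))
    (Finset.single_le_sum (f := fun a => pA q a * ∑ b, pB q b * V a b y)
    (fun a _ => mul_nonneg ((hA q).1 a) (Finset.sum_nonneg fun b _ =>
      mul_nonneg ((hB q).1 b) ((hV a b).1 y))) (Finset.mem_univ a))

variable [Fintype 𝒬] {pQ : 𝒬 → ℝ}

/-- The joint law of time-sharing symbol, inputs and output. -/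
def outJoint (pQ : 𝒬 → ℝ) (pA : 𝒬 → A → ℝ) (pB : 𝒬 → B → ℝ) (V : A → B → Y → ℝ) :
    𝒬 × A × B × Y → ℝ :=
  fun z => pQ z.1 * (pA z.1 z.2.1 * (pB z.1 z.2.2.1 * V z.2.1 z.2.2.1 z.2.2.2))

theorem isPMF_outJoint (hQ : IsPMF pQ) (hA : ∀ q, IsPMF (pA q)) (hB : ∀ q, IsPMF (pB q))
    (hV : ∀ a b, IsPMF (V a b)) : IsPMF (outJoint pQ pA pB V) := by
  refine ⟨fun z => mul_nonneg (hQ.1 _) (mul_nonneg ((hA _).1 _) (mul_nonneg ((hB _).1 _)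
    ((hV _ _).1 _))), ?_⟩
  simp only [outJoint, Fintype.sum_prod_type, ← Finset.mul_sum, (hV _ _).2, (hB _).2, (hA _).2,
    hQ.2, mul_one]

theorem pos_of_outJoint_pos (hQ : IsPMF pQ) (hA : ∀ q, IsPMF (pA q)) (hB : ∀ q, IsPMF (pB q))
    (hV : ∀ a b, IsPMF (V a b)) {z : 𝒬 × A × B × Y} (hz : outJoint pQ pA pB V z ≠ 0) :
    0 < pQ z.1 ∧ 0 < pA z.1 z.2.1 ∧ 0 < pB z.1 z.2.2.1 ∧ 0 < V z.2.1 z.2.2.1 z.2.2.2 := by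
  simp only [outJoint, ne_eq, mul_eq_zero, not_or] at hz
  exact ⟨(hQ.1 _).lt_of_ne' hz.1, ((hA _).1 _).lt_of_ne' hz.2.1,
    ((hB _).1 _).lt_of_ne' hz.2.2.1, ((hV _ _).1 _).lt_of_ne' hz.2.2.2⟩

theorem sum_block_eq (n : ℕ) (F : (Fin n → 𝒬 × A × B × Y) → ℝ) :
    ∑ q : Fin n → 𝒬, (∏ i, pQ (q i)) * ∑ a : Fin n → A, (∏ i, pA (q i) (a i)) *
      ∑ b : Fin n → B, (∏ i, pB (q i) (b i)) * ∑ y : Fin n → Y, (∏ i, V (a i) (b i) (y i)) *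
        F (fun i => (q i, a i, b i, y i)) =
    ∑ z, (∏ i, outJoint pQ pA pB V (z i)) * F z := by
  rw [sum_arrow_prod]
  refine Finset.sum_congr rfl fun q _ => ?_
  rw [sum_arrow_prod, Finset.mul_sum]
  refine Finset.sum_congr rfl fun a _ => ?_
  rw [sum_arrow_prod, Finset.mul_sum, Finset.mul_sum]
  refine Finset.sum_congr rfl fun b _ => ?_
  rw [Finset.mul_sum, Finset.mul_sum, Finset.mul_sum]
  refine Finset.sum_congr rfl fun y _ => ?_
  simp only [outJoint, Finset.prod_mul_distrib]
  ring

/-- The error probability of decoding the first message, averaged over the ensemble. -/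
def avgErr (pQ : 𝒬 → ℝ) (pA : 𝒬 → A → ℝ) (pB : 𝒬 → B → ℝ) (V : A → B → Y → ℝ) {n M N : ℕ}
    (d : (Fin n → 𝒬) → (Fin M → Fin n → A) → (Fin N → Fin n → B) → (Fin n → Y) → Fin M) : ℝ :=
  ∑ q : Fin n → 𝒬, (∏ i, pQ (q i)) * ∑ s : Fin M → Fin n → A, (∏ m, ∏ i, pA (q i) (s m i)) *
    ∑ t : Fin N → Fin n → B, (∏ k, ∏ i, pB (q i) (t k i)) *
      (((M : ℝ) * (N : ℝ))⁻¹ * ∑ m, ∑ k, ∑ y : Fin n → Y,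
        (∏ i, V (s m i) (t k i) (y i)) * (if d q s t y = m then 0 else 1))

theorem exists_block_converse (hQ : IsPMF pQ) (hA : ∀ q, IsPMF (pA q)) (hB : ∀ q, IsPMF (pB q))
    (hV : ∀ a b, IsPMF (V a b)) {hYQ hYA hYAB : ℝ}
    (hYQ_eq : hYQ = ∑ z, outJoint pQ pA pB V z * -Real.log (outQ pA pB V z.1 z.2.2.2))
    (hYA_eq : hYA = ∑ z, outJoint pQ pA pB V z * -Real.log (outA pB V z.1 z.2.1 z.2.2.2))
    (hYAB_eq : hYAB = ∑ z, outJoint pQ pA pB V z * -Real.log (V z.2.1 z.2.2.1 z.2.2.2)) :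
    ∃ K : ℝ, ∀ (n M N : ℕ) [NeZero M] [NeZero N]
      (d : (Fin n → 𝒬) → (Fin M → Fin n → A) → (Fin N → Fin n → B) → (Fin n → Y) → Fin M),
      Real.log M - n * hYQ + min (Real.log N + n * hYAB) (n * hYA) - K * √n ≤
        2 * Real.log 2 + Real.log M * avgErr pQ pA pB V d := by
  have hP := isPMF_outJoint hQ hA hB hV
  obtain ⟨K₁, hK₁⟩ := exists_mean_abs_deviation_le hP
    fun z => -Real.log (outQ pA pB V z.1 z.2.2.2)
  obtain ⟨K₂, hK₂⟩ := exists_mean_abs_deviation_le hP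
    fun z => -Real.log (outA pB V z.1 z.2.1 z.2.2.2)
  obtain ⟨K₃, hK₃⟩ := exists_mean_abs_deviation_le hP
    fun z => -Real.log (V z.2.1 z.2.2.1 z.2.2.2)
  rw [← hYQ_eq] at hK₁
  rw [← hYA_eq] at hK₂
  rw [← hYAB_eq] at hK₃
  refine ⟨K₁ + K₂ + K₃, fun n M N _ _ d => ?_⟩
  have hN0 : (0 : ℝ) < N := by exact_mod_cast Nat.pos_of_ne_zero (NeZero.ne N)
  set Pn : (Fin n → 𝒬 × A × B × Y) → ℝ := fun z => ∏ i, outJoint pQ pA pB V (z i) with hPn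
  have hPnP : IsPMF Pn := IsPMF.pi fun _ => hP
  set Φ : (Fin n → 𝒬 × A × B × Y) → ℝ := fun z =>
    Real.log (∏ i, outQ pA pB V (z i).1 (z i).2.2.2) -
      Real.log ((N : ℝ)⁻¹ * ∏ i, V (z i).2.1 (z i).2.2.1 (z i).2.2.2 +
        ∏ i, outA pB V (z i).1 (z i).2.1 (z i).2.2.2) with hΦ
  have shot : ∀ q : Fin n → 𝒬, _ := fun q => one_shot_converse (ι := Fin M) (κ := Fin N)
    (IsPMF.pi fun i => hA (q i)) (IsPMF.pi fun i => hB (q i))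
    (V := fun (a : Fin n → A) (b : Fin n → B) (y : Fin n → Y) => ∏ i, V (a i) (b i) (y i))
    (fun a b => IsPMF.pi fun i => hV (a i) (b i)) (d q)
  simp only [sum_block_outA, Fintype.card_fin] at shot
  have hQn : IsPMF fun q : Fin n → 𝒬 => ∏ i, pQ (q i) := IsPMF.pi fun _ => hQ
  have total := Finset.sum_le_sum fun q (_ : q ∈ (Finset.univ : Finset (Fin n → 𝒬))) =>
    mul_le_mul_of_nonneg_left (shot q) (hQn.1 q)
  have hshot : Real.log M + ∑ z, Pn z * Φ z ≤
      Real.log 2 + Real.log M * avgErr pQ pA pB V d := by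
    simp only [mul_add, Finset.sum_add_distrib, ← Finset.sum_mul, hQn.2, one_mul,
      mul_left_comm _ (Real.log (M : ℝ)), ← Finset.mul_sum] at total
    rw [← sum_block_eq]
    exact total
  have pt : ∀ z, Pn z * (-(n * hYQ) - Real.log 2 + min (Real.log N + n * hYAB) (n * hYA)) -
      Pn z * |∑ i, -Real.log (outQ pA pB V (z i).1 (z i).2.2.2) - n * hYQ| -
      Pn z * |∑ i, -Real.log (outA pB V (z i).1 (z i).2.1 (z i).2.2.2) - n * hYA| -
      Pn z * |∑ i, -Real.log (V (z i).2.1 (z i).2.2.1 (z i).2.2.2) - n * hYAB| ≤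
      Pn z * Φ z := by
    intro z
    rcases (hPnP.1 z).eq_or_lt with h0 | hpos
    · simp [← h0]
    have hi : ∀ i, _ := fun i => pos_of_outJoint_pos hQ hA hB hV
      (Finset.prod_ne_zero_iff.1 hpos.ne' i (Finset.mem_univ i))
    have hqp : ∀ i, 0 < outQ pA pB V (z i).1 (z i).2.2.2 := fun i =>
      outQ_pos hA hB hV (hi i).2.1 (hi i).2.2.1 (hi i).2.2.2
    have hap : ∀ i, 0 < outA pB V (z i).1 (z i).2.1 (z i).2.2.2 := fun i =>
      outA_pos hB hV (hi i).2.2.1 (hi i).2.2.2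
    have hvp : ∀ i, 0 < V (z i).2.1 (z i).2.2.1 (z i).2.2.2 := fun i => (hi i).2.2.2
    have hlog := log_add_le_log_two_add_max
      (mul_pos (inv_pos.2 hN0) (Finset.prod_pos fun i (_ : i ∈ Finset.univ) => hvp i))
      (Finset.prod_pos fun i (_ : i ∈ Finset.univ) => hap i)
    rw [Real.log_mul (inv_pos.2 hN0).ne' (Finset.prod_pos fun i _ => hvp i).ne', Real.log_inv,
      Real.log_prod fun i _ => (hvp i).ne', Real.log_prod fun i _ => (hap i).ne'] at hlog
    simp only [← mul_sub]
    refine mul_le_mul_of_nonneg_left ?_ hpos.le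
    simp only [hΦ]
    rw [Real.log_prod fun i _ => (hqp i).ne']
    simp only [Finset.sum_neg_distrib]
    set S₁ := ∑ i, Real.log (outQ pA pB V (z i).1 (z i).2.2.2)
    set S₂ := ∑ i, Real.log (outA pB V (z i).1 (z i).2.1 (z i).2.2.2)
    set S₃ := ∑ i, Real.log (V (z i).2.1 (z i).2.2.1 (z i).2.2.2)
    have h₁ := le_abs_self (-S₁ - n * hYQ)
    have h₂ := neg_abs_le (-S₂ - n * hYA)
    have h₂' := abs_nonneg (-S₂ - n * hYA)
    have h₃ := neg_abs_le (-S₃ - n * hYAB)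
    have h₃' := abs_nonneg (-S₃ - n * hYAB)
    rcases max_choice (-Real.log N + S₃) S₂ with h | h <;> rw [h] at hlog
    · have := min_le_left (Real.log N + n * hYAB) (n * hYA)
      linarith
    · have := min_le_right (Real.log N + n * hYAB) (n * hYA)
      linarith
  have sum_pt := Finset.sum_le_sum fun z (_ : z ∈ Finset.univ) => pt z
  simp only [Finset.sum_sub_distrib, ← Finset.sum_mul, hPnP.2, one_mul] at sum_pt
  linarith [hK₁ n, hK₂ n, hK₃ n]

end Block

theorem entOf_eq_sum {Ω β : Type*} [Fintype Ω] [Fintype β] [DecidableEq β] (p : Ω → ℝ)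
    (f : Ω → β) : entOf p f = -∑ ω, p ω * Real.logb 2 (distOf p f (f ω)) := by
  simp only [entOf, ent]
  congr 1
  calc _ = ∑ b, ∑ ω, if f ω = b then p ω * Real.logb 2 (distOf p f b) else 0 := by
        refine Finset.sum_congr rfl fun b _ => ?_
        nth_rewrite 1 [distOf]
        rw [Finset.sum_mul]
        exact Finset.sum_congr rfl fun ω _ => by split_ifs <;> simp
    _ = _ := by
        rw [Finset.sum_comm]
        simp

/-- A conditional entropy is the mean of the negative log of a conditional probability. -/
theorem entOf_sub_entOf {Ω β γ : Type*} [Fintype Ω] [Fintype β] [DecidableEq β] [Fintype γ]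
    [DecidableEq γ] {p : Ω → ℝ} {f : Ω → β} {g : Ω → γ} {κ : Ω → ℝ}
    (h : ∀ ω, p ω ≠ 0 → 0 < distOf p g (g ω) ∧ 0 < κ ω ∧
      distOf p f (f ω) = distOf p g (g ω) * κ ω) :
    (entOf p f - entOf p g) * Real.log 2 = ∑ ω, p ω * -Real.log (κ ω) := by
  have hl : Real.log 2 ≠ 0 := (Real.log_pos one_lt_two).ne'
  rw [entOf_eq_sum, entOf_eq_sum, neg_sub_neg, ← Finset.sum_sub_distrib, Finset.sum_mul]
  refine Finset.sum_congr rfl fun ω _ => ?_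
  by_cases h0 : p ω = 0
  · simp [h0]
  obtain ⟨hg, hκ, he⟩ := h ω h0
  rw [he, Real.logb, Real.logb, Real.log_mul hg.ne' hκ.ne']
  field_simp
  ring

theorem distOf_comp_equiv {Ω Ω' β : Type*} [Fintype Ω] [Fintype Ω'] [DecidableEq β]
    (e : Ω' ≃ Ω) (p : Ω → ℝ) (f : Ω → β) : distOf (p ∘ e) (f ∘ e) = distOf p f := by
  funext b
  exact e.sum_comp fun ω => if f ω = b then p ω else 0

theorem entOf_comp_equiv {Ω Ω' β : Type*} [Fintype Ω] [Fintype Ω'] [Fintype β] [DecidableEq β]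
    (e : Ω' ≃ Ω) (p : Ω → ℝ) (f : Ω → β) : entOf (p ∘ e) (f ∘ e) = entOf p f := by
  rw [entOf, distOf_comp_equiv, entOf]

theorem entOf_equiv_comp {Ω β γ : Type*} [Fintype Ω] [Fintype β] [DecidableEq β] [Fintype γ]
    [DecidableEq γ] (e : β ≃ γ) (p : Ω → ℝ) (f : Ω → β) :
    entOf p (fun ω => e (f ω)) = entOf p f := by
  simp only [entOf_eq_sum, distOf, e.injective.eq_iff]

section Marginals

variable {pQ pX1 pX2 W}

/-- The channel seen by the first receiver. -/
def margY1 (W : X1 → X2 → Y1 × Y2 → ℝ) (x1 : X1) (x2 : X2) (y1 : Y1) : ℝ := ∑ y2, W x1 x2 (y1, y2)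

theorem isPMF_margY1 (hW : ∀ x1 x2, IsPMF (W x1 x2)) (x1 : X1) (x2 : X2) :
    IsPMF (margY1 W x1 x2) :=
  ⟨fun y1 => Finset.sum_nonneg fun y2 _ => (hW x1 x2).1 _, by
    rw [← (hW x1 x2).2, Fintype.sum_prod_type]; rfl⟩

theorem sum_jointP_mul (F : Q × X1 × X2 × Y1 → ℝ) :
    ∑ z, jointP pQ pX1 pX2 W z * F (z.1, z.2.1, z.2.2.1, z.2.2.2.1) =
      ∑ z, outJoint pQ pX1 pX2 (margY1 W) z * F z := by
  simp only [jointP, outJoint, margY1, Fintype.sum_prod_type, ← Finset.sum_mul, ← Finset.mul_sum,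
    mul_assoc]

theorem distOf_jointP {β : Type*} [DecidableEq β] (f : Q × X1 × X2 × Y1 → β) (b : β) :
    distOf (jointP pQ pX1 pX2 W) (fun z => f (z.1, z.2.1, z.2.2.1, z.2.2.2.1)) b =
      distOf (outJoint pQ pX1 pX2 (margY1 W)) f b := by
  have h := sum_jointP_mul (pQ := pQ) (pX1 := pX1) (pX2 := pX2) (W := W)
    fun z => if f z = b then 1 else 0
  simp only [mul_ite, mul_one, mul_zero] at h
  exact h

theorem entOf_jointP {β : Type*} [Fintype β] [DecidableEq β] (f : Q × X1 × X2 × Y1 → β) :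
    entOf (jointP pQ pX1 pX2 W) (fun z => f (z.1, z.2.1, z.2.2.1, z.2.2.2.1)) =
      entOf (outJoint pQ pX1 pX2 (margY1 W)) f := by
  rw [entOf, entOf]
  congr 1
  funext b
  exact distOf_jointP f b

end Marginals

section SingleLetter

variable {𝒬 A B Y : Type*} [Fintype 𝒬] [DecidableEq 𝒬] [Fintype A] [DecidableEq A]
  [Fintype B] [DecidableEq B] [Fintype Y] [DecidableEq Y]
  {pQ : 𝒬 → ℝ} {pA : 𝒬 → A → ℝ} {pB : 𝒬 → B → ℝ} {V : A → B → Y → ℝ}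

theorem distOf_outJoint_q (hA : ∀ q, IsPMF (pA q)) (hB : ∀ q, IsPMF (pB q))
    (hV : ∀ a b, IsPMF (V a b)) (q : 𝒬) :
    distOf (outJoint pQ pA pB V) (fun z => z.1) q = pQ q := by
  simp [distOf, outJoint, Fintype.sum_prod_type, ← Finset.mul_sum, (hV _ _).2, (hB _).2, (hA _).2]

theorem distOf_outJoint_yq (y : Y) (q : 𝒬) :
    distOf (outJoint pQ pA pB V) (fun z => (z.2.2.2, z.1)) (y, q) = pQ q * outQ pA pB V q y := by
  simp [distOf, outJoint, outQ, outA, Fintype.sum_prod_type, ← Finset.mul_sum, ite_and]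

theorem distOf_outJoint_aq (hB : ∀ q, IsPMF (pB q)) (hV : ∀ a b, IsPMF (V a b)) (a : A) (q : 𝒬) :
    distOf (outJoint pQ pA pB V) (fun z => (z.2.1, z.1)) (a, q) = pQ q * pA q a := by
  simp [distOf, outJoint, Fintype.sum_prod_type, ← Finset.mul_sum, (hV _ _).2, (hB _).2, ite_and]

theorem distOf_outJoint_ayq (a : A) (y : Y) (q : 𝒬) :
    distOf (outJoint pQ pA pB V) (fun z => (z.2.1, z.2.2.2, z.1)) (a, y, q) =
      pQ q * pA q a * outA pB V q a y := by
  simp [distOf, outJoint, outA, Fintype.sum_prod_type, ← Finset.mul_sum, ite_and, mul_assoc]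

theorem distOf_outJoint_abq (hV : ∀ a b, IsPMF (V a b)) (a : A) (b : B) (q : 𝒬) :
    distOf (outJoint pQ pA pB V) (fun z => ((z.2.1, z.2.2.1), z.1)) ((a, b), q) =
      pQ q * pA q a * pB q b := by
  simp [distOf, outJoint, Fintype.sum_prod_type, ← Finset.mul_sum, (hV _ _).2, ite_and, mul_assoc]

theorem distOf_outJoint_abyq (a : A) (b : B) (y : Y) (q : 𝒬) :
    distOf (outJoint pQ pA pB V) (fun z => ((z.2.1, z.2.2.1), z.2.2.2, z.1)) ((a, b), y, q) =
      pQ q * pA q a * pB q b * V a b y := by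
  simp [distOf, outJoint, Fintype.sum_prod_type, ite_and, mul_assoc]

theorem condEnt_y_q (hQ : IsPMF pQ) (hA : ∀ q, IsPMF (pA q)) (hB : ∀ q, IsPMF (pB q))
    (hV : ∀ a b, IsPMF (V a b)) :
    (entOf (outJoint pQ pA pB V) (fun z => (z.2.2.2, z.1)) -
      entOf (outJoint pQ pA pB V) (fun z => z.1)) * Real.log 2 =
    ∑ z, outJoint pQ pA pB V z * -Real.log (outQ pA pB V z.1 z.2.2.2) := by
  refine entOf_sub_entOf fun z hz => ?_
  obtain ⟨h1, h2, h3, h4⟩ := pos_of_outJoint_pos hQ hA hB hV hz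
  rw [distOf_outJoint_q hA hB hV, distOf_outJoint_yq]
  exact ⟨h1, outQ_pos hA hB hV h2 h3 h4, rfl⟩

theorem condEnt_y_aq (hQ : IsPMF pQ) (hA : ∀ q, IsPMF (pA q)) (hB : ∀ q, IsPMF (pB q))
    (hV : ∀ a b, IsPMF (V a b)) :
    (entOf (outJoint pQ pA pB V) (fun z => (z.2.1, z.2.2.2, z.1)) -
      entOf (outJoint pQ pA pB V) (fun z => (z.2.1, z.1))) * Real.log 2 =
    ∑ z, outJoint pQ pA pB V z * -Real.log (outA pB V z.1 z.2.1 z.2.2.2) := by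
  refine entOf_sub_entOf fun z hz => ?_
  obtain ⟨h1, h2, h3, h4⟩ := pos_of_outJoint_pos hQ hA hB hV hz
  rw [distOf_outJoint_aq hB hV, distOf_outJoint_ayq]
  exact ⟨mul_pos h1 h2, outA_pos hB hV h3 h4, rfl⟩

theorem condEnt_y_abq (hQ : IsPMF pQ) (hA : ∀ q, IsPMF (pA q)) (hB : ∀ q, IsPMF (pB q))
    (hV : ∀ a b, IsPMF (V a b)) :
    (entOf (outJoint pQ pA pB V) (fun z => ((z.2.1, z.2.2.1), z.2.2.2, z.1)) -
      entOf (outJoint pQ pA pB V) (fun z => ((z.2.1, z.2.2.1), z.1))) * Real.log 2 =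
    ∑ z, outJoint pQ pA pB V z * -Real.log (V z.2.1 z.2.2.1 z.2.2.2) := by
  refine entOf_sub_entOf fun z hz => ?_
  obtain ⟨h1, h2, h3, h4⟩ := pos_of_outJoint_pos hQ hA hB hV hz
  rw [distOf_outJoint_abq hV, distOf_outJoint_abyq]
  exact ⟨mul_pos (mul_pos h1 h2) h3, h4, rfl⟩

end SingleLetter

theorem log_msgSize_le (n : ℕ) {R : ℝ} (hR : 0 ≤ R) :
    Real.log (msgSize n R) ≤ n * (R * Real.log 2) := by
  have h1 : (1 : ℝ) ≤ (2 : ℝ) ^ ((n : ℝ) * R) := Real.one_le_rpow one_le_two (by positivity)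
  have h2 : (msgSize n R : ℝ) ≤ (2 : ℝ) ^ ((n : ℝ) * R) := by
    simp only [msgSize, Nat.cast_max, Nat.cast_one]
    exact max_le h1 (Nat.floor_le (by positivity))
  have h3 : (0 : ℝ) < msgSize n R := by exact_mod_cast Nat.pos_of_ne_zero (NeZero.ne _)
  calc _ ≤ Real.log ((2 : ℝ) ^ ((n : ℝ) * R)) := Real.log_le_log h3 h2
    _ = _ := by rw [Real.log_rpow two_pos, mul_assoc]

theorem le_log_msgSize (n : ℕ) (R : ℝ) :
    n * (R * Real.log 2) - Real.log 2 ≤ Real.log (msgSize n R) := by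
  have h2 : (2 : ℝ) ^ ((n : ℝ) * R) / 2 ≤ msgSize n R := by
    simp only [msgSize, Nat.cast_max, Nat.cast_one]
    have := Nat.lt_floor_add_one ((2 : ℝ) ^ ((n : ℝ) * R))
    have := le_max_left (1 : ℝ) (⌊(2 : ℝ) ^ ((n : ℝ) * R)⌋₊ : ℝ)
    have := le_max_right (1 : ℝ) (⌊(2 : ℝ) ^ ((n : ℝ) * R)⌋₊ : ℝ)
    linarith
  calc _ = Real.log ((2 : ℝ) ^ ((n : ℝ) * R) / 2) := by
        rw [Real.log_div (by positivity) two_ne_zero, Real.log_rpow two_pos, mul_assoc]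
    _ ≤ _ := Real.log_le_log (by positivity) h2

theorem nonpos_of_mul_le_sublinear {δ C K r : ℝ} {e : ℕ → ℝ} (he : Tendsto e atTop (nhds 0))
    (h : ∀ n : ℕ, n * δ ≤ C + K * √n + n * (r * e n)) : δ ≤ 0 := by
  have h1 : Tendsto (fun n : ℕ => C * (n : ℝ)⁻¹) atTop (nhds (C * 0)) :=
    tendsto_natCast_atTop_atTop.inv_tendsto_atTop.const_mul C
  have h2 : Tendsto (fun n : ℕ => K * (√(n : ℝ))⁻¹) atTop (nhds (K * 0)) :=
    (Real.tendsto_sqrt_atTop.comp tendsto_natCast_atTop_atTop).inv_tendsto_atTop.const_mul K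
  have h3 := (h1.add h2).add (he.const_mul r)
  simp only [mul_zero, add_zero] at h3
  refine ge_of_tendsto h3 ?_
  filter_upwards [eventually_gt_atTop 0] with n hn
  have hn' : (0 : ℝ) < n := by exact_mod_cast hn
  have hs : √(n : ℝ) * √n = n := Real.mul_self_sqrt hn'.le
  have hs0 : (0 : ℝ) < √n := by positivity
  refine le_of_mul_le_mul_left ((h n).trans_eq ?_) hn'
  have e1 : (n : ℝ) * (C * (n : ℝ)⁻¹) = C := by field_simp
  have e2 : (n : ℝ) * (K * (√(n : ℝ))⁻¹) = K * √n := by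
    nth_rewrite 1 [← hs]
    field_simp
  rw [mul_add, mul_add, e1, e2]

section Decoding

variable {pQ pX1 pX2 W}

theorem avgErr_nonneg (hpQ : IsPMF pQ) (hpX1 : ∀ q, IsPMF (pX1 q)) (hpX2 : ∀ q, IsPMF (pX2 q))
    {V : X1 → X2 → Y1 → ℝ} (hV : ∀ x1 x2, IsPMF (V x1 x2)) {n M N : ℕ}
    (d : (Fin n → Q) → (Fin M → Fin n → X1) → (Fin N → Fin n → X2) → (Fin n → Y1) → Fin M) :
    0 ≤ avgErr pQ pX1 pX2 V d := by
  refine Finset.sum_nonneg fun q _ => mul_nonneg (Finset.prod_nonneg fun i _ => hpQ.1 _) ?_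
  refine Finset.sum_nonneg fun s _ => mul_nonneg
    (Finset.prod_nonneg fun m _ => Finset.prod_nonneg fun i _ => (hpX1 _).1 _) ?_
  refine Finset.sum_nonneg fun t _ => mul_nonneg
    (Finset.prod_nonneg fun m _ => Finset.prod_nonneg fun i _ => (hpX2 _).1 _) ?_
  refine mul_nonneg (by positivity) (Finset.sum_nonneg fun m _ => Finset.sum_nonneg fun k _ =>
    Finset.sum_nonneg fun y _ => mul_nonneg (Finset.prod_nonneg fun i _ => (hV _ _).1 _) ?_)
  split_ifs <;> simp

theorem err_le_PeCode (hW : ∀ x1 x2, IsPMF (W x1 x2)) {n M1 M2 : ℕ}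
    (c : Codebook Q X1 X2 n M1 M2) (d1 : (Fin n → Y1) → Fin M1) (d2 : (Fin n → Y2) → Fin M2) :
    ((M1 : ℝ) * (M2 : ℝ))⁻¹ * ∑ m, ∑ k, ∑ y : Fin n → Y1,
        (∏ i, margY1 W (c.2.1 m i) (c.2.2 k i) (y i)) * (if d1 y = m then 0 else 1) ≤
      PeCode W c d1 d2 := by
  refine mul_le_mul_of_nonneg_left (Finset.sum_le_sum fun m _ => Finset.sum_le_sum fun k _ =>
    Finset.sum_le_sum fun y _ => ?_) (by positivity)
  simp only [margY1]
  rw [Fintype.prod_sum, Finset.sum_mul]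
  refine Finset.sum_le_sum fun y2 _ => mul_le_mul_of_nonneg_left ?_
    (Finset.prod_nonneg fun i _ => (hW _ _).1 _)
  by_cases h : d1 y = m
  · simp only [h, if_true]; split_ifs <;> simp
  · simp [h]

theorem exists_avgErr_le_avgPeOpt (hpQ : IsPMF pQ) (hpX1 : ∀ q, IsPMF (pX1 q))
    (hpX2 : ∀ q, IsPMF (pX2 q)) (hW : ∀ x1 x2, IsPMF (W x1 x2)) (R1 R2 : ℝ) (n : ℕ) :
    ∃ d : (Fin n → Q) → (Fin (msgSize n R1) → Fin n → X1) → (Fin (msgSize n R2) → Fin n → X2) →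
      (Fin n → Y1) → Fin (msgSize n R1),
      avgErr pQ pX1 pX2 (margY1 W) d ≤ avgPeOpt pQ pX1 pX2 W R1 R2 n := by
  have hmin : ∀ c : Codebook Q X1 X2 n (msgSize n R1) (msgSize n R2),
      ∃ d : ((Fin n → Y1) → Fin (msgSize n R1)) × ((Fin n → Y2) → Fin (msgSize n R2)),
        PeCode W c d.1 d.2 = PeOpt W c := fun c => exists_eq_ciInf_of_finite
  choose d hd using hmin
  refine ⟨fun q s t => (d (q, s, t)).1, ?_⟩
  simp only [avgErr, avgPeOpt]
  rw [Fintype.sum_prod_type]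
  refine Finset.sum_le_sum fun q _ => ?_
  rw [Fintype.sum_prod_type, Finset.mul_sum]
  refine Finset.sum_le_sum fun s _ => ?_
  rw [Finset.mul_sum, Finset.mul_sum]
  refine Finset.sum_le_sum fun t _ => ?_
  rw [← hd, ensembleP, ← mul_assoc, ← mul_assoc]
  refine mul_le_mul_of_nonneg_left (err_le_PeCode hW (q, s, t) _ _) ?_
  exact mul_nonneg (mul_nonneg (Finset.prod_nonneg fun i _ => hpQ.1 _)
    (Finset.prod_nonneg fun m _ => Finset.prod_nonneg fun i _ => (hpX1 _).1 _))
    (Finset.prod_nonneg fun m _ => Finset.prod_nonneg fun i _ => (hpX2 _).1 _)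

theorem mem_Region1_of_tendsto
    (hpQ : IsPMF pQ) (hpX1 : ∀ q, IsPMF (pX1 q)) (hpX2 : ∀ q, IsPMF (pX2 q))
    (hW : ∀ x1 x2, IsPMF (W x1 x2)) {R1 R2 : ℝ} (hR1 : 0 ≤ R1) (hR2 : 0 ≤ R2)
    (hach : Tendsto (fun n => avgPeOpt pQ pX1 pX2 W R1 R2 n) atTop (nhds 0)) :
    (R1, R2) ∈ Region1 pQ pX1 pX2 W := by
  have hV := isPMF_margY1 hW
  have hL : 0 < Real.log 2 := Real.log_pos one_lt_two
  obtain ⟨K, hK⟩ := exists_block_converse hpQ hpX1 hpX2 hV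
    (condEnt_y_q hpQ hpX1 hpX2 hV) (condEnt_y_aq hpQ hpX1 hpX2 hV)
    (condEnt_y_abq hpQ hpX1 hpX2 hV)
  set P := outJoint pQ pX1 pX2 (margY1 W) with hP
  set hYQ := entOf P (fun z => (z.2.2.2, z.1)) - entOf P (fun z => z.1) with hYQ_def
  set hYA := entOf P (fun z => (z.2.1, z.2.2.2, z.1)) - entOf P (fun z => (z.2.1, z.1))
    with hYA_def
  set hYAB := entOf P (fun z => ((z.2.1, z.2.2.1), z.2.2.2, z.1)) -
    entOf P (fun z => ((z.2.1, z.2.2.1), z.1)) with hYAB_def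
  have main : R1 - hYQ + min (R2 + hYAB) hYA ≤ 0 := by
    have : (R1 - hYQ + min (R2 + hYAB) hYA) * Real.log 2 ≤ 0 := by
      refine nonpos_of_mul_le_sublinear (C := 4 * Real.log 2) (K := K) (r := R1 * Real.log 2)
        hach fun n => ?_
      obtain ⟨d, hd⟩ := exists_avgErr_le_avgPeOpt hpQ hpX1 hpX2 hW R1 R2 n
      have h0 := avgErr_nonneg hpQ hpX1 hpX2 hV d
      have h1 := hK n _ _ d
      have h2 := log_msgSize_le n hR1
      have h3 := le_log_msgSize n R1
      have h4 := le_log_msgSize n R2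
      have hn : (0 : ℝ) ≤ n := n.cast_nonneg
      have h5 : Real.log (msgSize n R1) * avgErr pQ pX1 pX2 (margY1 W) d ≤
          n * (R1 * Real.log 2 * avgPeOpt pQ pX1 pX2 W R1 R2 n) := by
        rw [← mul_assoc (n : ℝ)]
        exact mul_le_mul h2 hd h0 (by positivity)
      have h6 : n * (min (R2 + hYAB) hYA * Real.log 2) - Real.log 2 ≤
          min (Real.log (msgSize n R2) + n * (hYAB * Real.log 2)) (n * (hYA * Real.log 2)) := by
        have m1 : n * (min (R2 + hYAB) hYA * Real.log 2) ≤ n * ((R2 + hYAB) * Real.log 2) := by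
          gcongr; exact min_le_left _ _
        have m2 : n * (min (R2 + hYAB) hYA * Real.log 2) ≤ n * (hYA * Real.log 2) := by
          gcongr; exact min_le_right _ _
        refine le_min ?_ ?_ <;> linarith
      linarith
    exact nonpos_of_mul_nonpos_left this hL
  have hq : entOf (jointP pQ pX1 pX2 W) vQ = entOf P (fun z => z.1) := entOf_jointP fun z => z.1
  have c1 : condMutInfo (jointP pQ pX1 pX2 W) vX1 vY1 vQ = hYQ - hYA := by
    simp only [condMutInfo, vX1, vY1, vQ]
    rw [entOf_jointP fun z => (z.2.1, z.1), entOf_jointP fun z => (z.2.2.2, z.1),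
      entOf_jointP fun z => (z.2.1, z.2.2.2, z.1), hq]
    simp only [hYQ_def, hYA_def]
    ring
  have c2 : condMutInfo (jointP pQ pX1 pX2 W) vX2 vY1 (fun z => (vX1 z, vQ z)) = hYA - hYAB := by
    simp only [condMutInfo, vX1, vX2, vY1, vQ]
    rw [entOf_jointP fun z => (z.2.2.1, z.2.1, z.1),
      entOf_jointP fun z => (z.2.2.2, z.2.1, z.1),
      entOf_jointP fun z => (z.2.2.1, z.2.2.2, z.2.1, z.1), entOf_jointP fun z => (z.2.1, z.1)]
    have e1 := entOf_equiv_comp (⟨fun t => (t.1.2, t.1.1, t.2), fun t => ((t.2.1, t.1), t.2.2),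
      fun _ => rfl, fun _ => rfl⟩ : (X1 × X2) × Q ≃ X2 × X1 × Q) P
      fun z => ((z.2.1, z.2.2.1), z.1)
    have e2 := entOf_equiv_comp (⟨fun t => (t.2.1, t.1, t.2.2), fun t => (t.2.1, t.1, t.2.2),
      fun _ => rfl, fun _ => rfl⟩ : X1 × Y1 × Q ≃ Y1 × X1 × Q) P
      fun z => (z.2.1, z.2.2.2, z.1)
    have e3 := entOf_equiv_comp (⟨fun t => (t.1.2, t.2.1, t.1.1, t.2.2),
      fun t => ((t.2.2.1, t.1), t.2.1, t.2.2.2),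
      fun _ => rfl, fun _ => rfl⟩ : (X1 × X2) × Y1 × Q ≃ X2 × Y1 × X1 × Q) P
      fun z => ((z.2.1, z.2.2.1), z.2.2.2, z.1)
    simp only [Equiv.coe_fn_mk] at e1 e2 e3
    rw [e1, e2, e3]
    simp only [hYA_def, hYAB_def]
    ring
  have c3 : condMutInfo (jointP pQ pX1 pX2 W) (fun z => (vX1 z, vX2 z)) vY1 vQ =
      hYQ - hYAB := by
    simp only [condMutInfo, vX1, vX2, vY1, vQ]
    rw [entOf_jointP fun z => ((z.2.1, z.2.2.1), z.1), entOf_jointP fun z => (z.2.2.2, z.1),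
      entOf_jointP fun z => ((z.2.1, z.2.2.1), z.2.2.2, z.1), hq]
    simp only [hYQ_def, hYAB_def]
    ring
  refine ⟨hR1, hR2, ?_⟩
  rw [c1, c2, c3]
  dsimp only
  rcases le_total (R2 + hYAB) hYA with h | h
  · rw [min_eq_left h] at main
    exact Or.inr ⟨by linarith, by linarith⟩
  · rw [min_eq_right h] at main
    exact Or.inl (by linarith)

end Decoding

section Swap

/-- The channel with the two user pairs exchanged. -/
def swapChannel (W : X1 → X2 → Y1 × Y2 → ℝ) : X2 → X1 → Y2 × Y1 → ℝ :=
  fun x2 x1 y => W x1 x2 y.swap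

theorem PeCode_swapChannel {n M1 M2 : ℕ} (c : Codebook Q X1 X2 n M1 M2)
    (d1 : (Fin n → Y1) → Fin M1) (d2 : (Fin n → Y2) → Fin M2) :
    PeCode (swapChannel W) ((c.1, c.2.2, c.2.1) : Codebook Q X2 X1 n M2 M1) d2 d1 =
      PeCode W c d1 d2 := by
  simp only [PeCode, swapChannel, Prod.swap_prod_mk]
  rw [mul_comm (M2 : ℝ), Finset.sum_comm]
  congr 1
  refine Finset.sum_congr rfl fun m1 _ => Finset.sum_congr rfl fun m2 _ => ?_
  rw [Finset.sum_comm]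
  simp only [and_comm]

theorem PeOpt_swapChannel {n M1 M2 : ℕ} (c : Codebook Q X1 X2 n M1 M2) :
    PeOpt (swapChannel W) ((c.1, c.2.2, c.2.1) : Codebook Q X2 X1 n M2 M1) = PeOpt W c :=
  (Equiv.prodComm _ _).iInf_congr fun d => (PeCode_swapChannel W c d.2 d.1).symm

theorem avgPeOpt_swapChannel (R1 R2 : ℝ) (n : ℕ) :
    avgPeOpt pQ pX2 pX1 (swapChannel W) R2 R1 n = avgPeOpt pQ pX1 pX2 W R1 R2 n := by
  simp only [avgPeOpt]
  rw [← ((Equiv.refl _).prodCongr (Equiv.prodComm _ _)).sum_comp]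
  refine Finset.sum_congr rfl fun c _ => ?_
  have h := PeOpt_swapChannel W c
  simp only [ensembleP, Equiv.prodCongr_apply, Prod.map, Equiv.coe_refl, id, Equiv.prodComm_apply,
    Prod.swap] at h ⊢
  rw [h]
  ring

/-- Exchange of the two user pairs on the single-letter sample space. -/
def swapLetters : Q × X1 × X2 × Y1 × Y2 ≃ Q × X2 × X1 × Y2 × Y1 where
  toFun z := (z.1, z.2.2.1, z.2.1, z.2.2.2.2, z.2.2.2.1)
  invFun z := (z.1, z.2.2.1, z.2.1, z.2.2.2.2, z.2.2.2.1)
  left_inv _ := rfl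
  right_inv _ := rfl

theorem jointP_swapChannel :
    jointP pQ pX2 pX1 (swapChannel W) ∘ swapLetters = jointP pQ pX1 pX2 W := by
  funext z
  simp only [jointP, swapChannel, swapLetters, Function.comp_apply, Equiv.coe_fn_mk,
    Prod.swap_prod_mk]
  ring

theorem entOf_swapChannel {β : Type*} [Fintype β] [DecidableEq β]
    (f : Q × X2 × X1 × Y2 × Y1 → β) :
    entOf (jointP pQ pX2 pX1 (swapChannel W)) f =
      entOf (jointP pQ pX1 pX2 W) (fun z => f (swapLetters z)) := by
  rw [← entOf_comp_equiv swapLetters, jointP_swapChannel]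
  rfl

theorem mem_Region2_of_swapChannel {R1 R2 : ℝ}
    (h : (R2, R1) ∈ Region1 pQ pX2 pX1 (swapChannel W)) : (R1, R2) ∈ Region2 pQ pX1 pX2 W := by
  obtain ⟨h2, h1, h⟩ := h
  refine ⟨h1, h2, ?_⟩
  have e1 := entOf_equiv_comp ((Equiv.prodComm X1 X2).prodCongr (Equiv.refl Q))
    (jointP pQ pX1 pX2 W) fun z => ((vX1 z, vX2 z), vQ z)
  have e2 := entOf_equiv_comp ((Equiv.prodComm X1 X2).prodCongr (Equiv.refl (Y2 × Q)))
    (jointP pQ pX1 pX2 W) fun z => ((vX1 z, vX2 z), vY2 z, vQ z)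
  simp only [Equiv.prodCongr_apply, Prod.map, Equiv.coe_refl, id, Equiv.prodComm_apply,
    Prod.swap] at e1 e2
  simp only [condMutInfo, entOf_swapChannel] at h
  simp only [vX1, vX2, vY1, vY2, vQ, swapLetters, Equiv.coe_fn_mk] at h e1 e2
  rw [e1, e2, add_comm R2] at h
  exact h

end Swap

/-- **Converse half of Theorem 1.** If the error probability of the maximum likelihood
decoders, averaged over the `(2^{nR1}, 2^{nR2}, n; p)` random code ensemble, tends to `0`
as `n → ∞`, then `(R1, R2)` lies in `𝓡₁(p) ∩ 𝓡₂(p)`. -/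
theorem converse_two_user_IC
    (hpQ : IsPMF pQ) (hpX1 : ∀ q, IsPMF (pX1 q)) (hpX2 : ∀ q, IsPMF (pX2 q))
    (hW : ∀ x1 x2, IsPMF (W x1 x2)) (R1 R2 : ℝ) (hR1 : 0 ≤ R1) (hR2 : 0 ≤ R2)
    (hach : Tendsto (fun n => avgPeOpt pQ pX1 pX2 W R1 R2 n) atTop (nhds 0)) :
    (R1, R2) ∈ Region1 pQ pX1 pX2 W ∩ Region2 pQ pX1 pX2 W := by
  exact ⟨mem_Region1_of_tendsto hpQ hpX1 hpX2 hW hR1 hR2 hach,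
    mem_Region2_of_swapChannel pQ pX1 pX2 W (mem_Region1_of_tendsto hpQ hpX2 hpX1
      (fun x2 x1 => ⟨fun y => (hW x1 x2).1 _, by
        rw [← (hW x1 x2).2]; exact (Equiv.prodComm Y2 Y1).sum_comp (W x1 x2)⟩) hR2 hR1
      (hach.congr fun n => (avgPeOpt_swapChannel pQ pX1 pX2 W R1 R2 n).symm))⟩

end TwoUser
end
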